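/- arXiv:1501.05097 — 5 statements merged into one kernel-verified Lean document; each statement's English description precedes it below -/
import Mathlib

section
/- Let H : ℝ^n × ℝ^n → ℝ and g : ℝ^n → ℝ^k be twice continuously differentiable, and let λ : ℝ^n × ℝ^n → ℝ^k be continuously differentiable. Define the constrained Hamiltonian vector field X(r, p) = (∇_p H(r, p), −∇_r H(r, p) − G(r)ᵀ λ(r, p)), where G(r) = Dg(r). Let x = (r, p) : ℝ → ℝ^n × ℝ^n be a solution of ẋ = X(x), and let ξ, η : ℝ → ℝ^n × ℝ^n be solutions of the variational equation ξ′(t) = DX(x(t)) ξ(t), η′(t) = DX(x(t)) η(t), whose configuration components are tangent to the constraint: G(r(t)) ξ_r(t) = 0 and G(r(t)) η_r(t) = 0 for all t. Then the canonical symplectic form is preserved: t ↦ ω(ξ(t), η(t)) = ⟨ξ_r(t), η_p(t)⟩ − ⟨ξ_p(t), η_r(t)⟩ is constant. -/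
open scoped BigOperators RealInnerProductSpace

section ConstrainedHamiltonian

variable {E : Type*} [NormedAddCommGroup E] [InnerProductSpace ℝ E]

theorem fderiv_partial_fst {H : E × E → ℝ} (hH : Differentiable ℝ H) (z : E × E) :
    fderiv ℝ (fun r => H (r, z.2)) z.1 = (fderiv ℝ H z).comp (.inl ℝ E E) :=
  ((hH z).hasFDerivAt.comp z.1 (hasFDerivAt_prodMk_left z.1 z.2)).fderiv

theorem fderiv_partial_snd {H : E × E → ℝ} (hH : Differentiable ℝ H) (z : E × E) :
    fderiv ℝ (fun p => H (z.1, p)) z.2 = (fderiv ℝ H z).comp (.inr ℝ E E) :=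
  ((hH z).hasFDerivAt.comp z.2 (hasFDerivAt_prodMk_right z.1 z.2)).fderiv

variable [CompleteSpace E]

/-- The Riesz map sending a functional on a real Hilbert space to its representing vector, as a
continuous `ℝ`-linear map. -/
noncomputable def rieszCLM : (E →L[ℝ] ℝ) →L[ℝ] E :=
  LinearMap.mkContinuous
    { toFun := fun φ => (InnerProductSpace.toDual ℝ E).symm φ
      map_add' := fun φ ψ => map_add _ φ ψ
      map_smul' := fun c φ => by simp } 1 (fun φ => by simp)

theorem inner_gradient_eq_fderiv (f : E → ℝ) (x v : E) :
    ⟪gradient f x, v⟫ = fderiv ℝ f x v := by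
  simp [gradient]

theorem differentiable_gradient_of_contDiff {f : E → ℝ} (hf : ContDiff ℝ 2 f) :
    Differentiable ℝ (gradient f) :=
  (rieszCLM (E := E)).differentiable.comp
    ((hf.fderiv_right (m := 1) (by norm_num)).differentiable (by norm_num))

theorem differentiable_gradient_partial_fst {H : E × E → ℝ} (hH : ContDiff ℝ 2 H) :
    Differentiable ℝ (fun z : E × E => gradient (fun r => H (r, z.2)) z.1) := by
  have hd : Differentiable ℝ (fderiv ℝ H) :=
    (hH.fderiv_right (m := 1) (by norm_num)).differentiable (by norm_num)
  have h : Differentiable ℝ (fun z => (fderiv ℝ H z).comp (.inl ℝ E E)) :=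
    hd.clm_comp (differentiable_const _)
  refine Eq.mp (congrArg (Differentiable ℝ) (funext fun z => ?_))
    ((rieszCLM (E := E)).differentiable.comp h)
  simp only [gradient, fderiv_partial_fst (hH.differentiable (by norm_num))]
  rfl

theorem differentiable_gradient_partial_snd {H : E × E → ℝ} (hH : ContDiff ℝ 2 H) :
    Differentiable ℝ (fun z : E × E => gradient (fun p => H (z.1, p)) z.2) := by
  have hd : Differentiable ℝ (fderiv ℝ H) :=
    (hH.fderiv_right (m := 1) (by norm_num)).differentiable (by norm_num)
  have h : Differentiable ℝ (fun z => (fderiv ℝ H z).comp (.inr ℝ E E)) :=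
    hd.clm_comp (differentiable_const _)
  refine Eq.mp (congrArg (Differentiable ℝ) (funext fun z => ?_))
    ((rieszCLM (E := E)).differentiable.comp h)
  simp only [gradient, fderiv_partial_snd (hH.differentiable (by norm_num))]
  rfl

variable {k : ℕ} {H : E × E → ℝ} {g : E → Fin k → ℝ} {lam : E × E → Fin k → ℝ}
  {X : E × E → E × E}

theorem differentiable_constrained_hamiltonian_field (hH : ContDiff ℝ 2 H)
    (hg : ContDiff ℝ 2 g) (hlam : ContDiff ℝ 1 lam)
    (hX : ∀ z, X z = (gradient (fun p' => H (z.1, p')) z.2,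
        - gradient (fun r' => H (r', z.2)) z.1
        - ∑ j, lam z j • gradient (fun r' => g r' j) z.1)) :
    Differentiable ℝ X := by
  rw [funext hX]
  have hl : ∀ j, Differentiable ℝ (fun z => lam z j) :=
    differentiable_pi.1 (hlam.differentiable (by norm_num))
  have hgj : ∀ j, Differentiable ℝ (fun z : E × E => gradient (fun r' => g r' j) z.1) :=
    fun j => (differentiable_gradient_of_contDiff (contDiff_pi.1 hg j)).comp differentiable_fst
  exact (differentiable_gradient_partial_snd hH).prodMk
    ((differentiable_gradient_partial_fst hH).neg.sub
      (Differentiable.fun_sum fun j _ => (hl j).smul (hgj j)))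

/-- Contracting the constrained Hamiltonian field with the symplectic form gives
`dH + ∑ λ_j dg^j`. -/
theorem symplectic_contraction_constrained_hamiltonian_field (hH : Differentiable ℝ H)
    (hX : ∀ z, X z = (gradient (fun p' => H (z.1, p')) z.2,
        - gradient (fun r' => H (r', z.2)) z.1
        - ∑ j, lam z j • gradient (fun r' => g r' j) z.1)) (z v : E × E) :
    ⟪(X z).1, v.2⟫ - ⟪(X z).2, v.1⟫
      = fderiv ℝ H z v + ∑ j, lam z j * fderiv ℝ (fun r => g r j) z.1 v.1 := by
  have hv : fderiv ℝ H z v = fderiv ℝ H z (v.1, 0) + fderiv ℝ H z (0, v.2) := by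
    rw [← map_add]; simp
  simp only [hX, inner_sub_left, inner_neg_left, sum_inner, real_inner_smul_left,
    inner_gradient_eq_fderiv, fderiv_partial_fst hH, fderiv_partial_snd hH,
    ContinuousLinearMap.comp_apply, ContinuousLinearMap.inl_apply,
    ContinuousLinearMap.inr_apply, hv]
  ring

/-- On a vector `v` tangent to the constraint, the symplectic form paired with the linearised
field is the Hessian of `H + ∑ λ_j g^j` with the multipliers frozen. -/
theorem symplectic_fderiv_constrained_hamiltonian_field (hH : ContDiff ℝ 2 H)
    (hg : ContDiff ℝ 2 g) (hlam : ContDiff ℝ 1 lam)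
    (hX : ∀ z, X z = (gradient (fun p' => H (z.1, p')) z.2,
        - gradient (fun r' => H (r', z.2)) z.1
        - ∑ j, lam z j • gradient (fun r' => g r' j) z.1)) (z w v : E × E)
    (hv : ∀ j, ⟪gradient (fun r' => g r' j) z.1, v.1⟫ = 0) :
    ⟪(fderiv ℝ X z w).1, v.2⟫ - ⟪(fderiv ℝ X z w).2, v.1⟫
      = fderiv ℝ (fderiv ℝ H) z w v
        + ∑ j, lam z j * fderiv ℝ (fderiv ℝ (fun r => g r j)) z.1 w.1 v.1 := by
  have hXd := (differentiable_constrained_hamiltonian_field hH hg hlam hX z).hasFDerivAt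
  have hl : ∀ j, HasFDerivAt (fun y => lam y j) (fderiv ℝ (fun y => lam y j) z) z := fun j =>
    (differentiable_pi.1 (hlam.differentiable (by norm_num)) j z).hasFDerivAt
  have hHd : HasFDerivAt (fderiv ℝ H) (fderiv ℝ (fderiv ℝ H) z) z :=
    ((hH.fderiv_right (m := 1) (by norm_num)).differentiable (by norm_num) z).hasFDerivAt
  have hgd : ∀ j, HasFDerivAt (fun y : E × E => fderiv ℝ (fun r => g r j) y.1)
      ((fderiv ℝ (fderiv ℝ (fun r => g r j)) z.1).comp (.fst ℝ E E)) z := fun j =>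
    HasFDerivAt.comp z
      ((((contDiff_pi.1 hg j).fderiv_right (m := 1) (by norm_num)).differentiable
        (by norm_num) z.1).hasFDerivAt) hasFDerivAt_fst
  have hL := (hXd.fst.inner ℝ (hasFDerivAt_const v.2 z)).sub
    (hXd.snd.inner ℝ (hasFDerivAt_const v.1 z))
  have hR := (hHd.clm_apply (hasFDerivAt_const v z)).add
    (HasFDerivAt.fun_sum (u := Finset.univ) fun j _ =>
      (hl j).mul ((hgd j).clm_apply (hasFDerivAt_const v.1 z)))
  have hfun := funext fun y => symplectic_contraction_constrained_hamiltonian_field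
    (hH.differentiable (by norm_num)) hX y v
  have key := DFunLike.congr_fun ((hL.congr_of_eventuallyEq (.of_eq hfun.symm)).unique hR) w
  have hv' : ∀ j, fderiv ℝ (fun r => g r j) z.1 v.1 = 0 := fun j => by
    rw [← inner_gradient_eq_fderiv, hv j]
  simpa [fderivInnerCLM_apply, hv'] using key

end ConstrainedHamiltonian

/-- Symplecticity of the constrained Hamiltonian flow: along solutions of the variational
equation of the constrained Hamiltonian vector field
`X(r,p) = (∇_p H, −∇_r H − G(r)ᵀ λ(r,p))` whose configuration components are tangent to
the constraint (`G(r)ξ_r = 0`, i.e. `⟨∇g^j(r), ξ_r⟩ = 0` for all `j`), the canonical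
symplectic form `ω(ξ,η) = ⟨ξ_r, η_p⟩ − ⟨ξ_p, η_r⟩` is constant in time. -/
theorem stmt9 {n k : ℕ}
    (H : EuclideanSpace ℝ (Fin n) × EuclideanSpace ℝ (Fin n) → ℝ) (hH : ContDiff ℝ 2 H)
    (g : EuclideanSpace ℝ (Fin n) → Fin k → ℝ) (hg : ContDiff ℝ 2 g)
    (lam : EuclideanSpace ℝ (Fin n) × EuclideanSpace ℝ (Fin n) → Fin k → ℝ)
    (hlam : ContDiff ℝ 1 lam)
    (X : EuclideanSpace ℝ (Fin n) × EuclideanSpace ℝ (Fin n) →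
         EuclideanSpace ℝ (Fin n) × EuclideanSpace ℝ (Fin n))
    (hX : ∀ z, X z = (gradient (fun p' => H (z.1, p')) z.2,
        - gradient (fun r' => H (r', z.2)) z.1
        - ∑ j, lam z j • gradient (fun r' => g r' j) z.1))
    (x : ℝ → EuclideanSpace ℝ (Fin n) × EuclideanSpace ℝ (Fin n))
    (hx : Differentiable ℝ x) (hxeq : ∀ t, deriv x t = X (x t))
    (ξ η : ℝ → EuclideanSpace ℝ (Fin n) × EuclideanSpace ℝ (Fin n))
    (hξ : Differentiable ℝ ξ) (hη : Differentiable ℝ η)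
    (hξeq : ∀ t, deriv ξ t = fderiv ℝ X (x t) (ξ t))
    (hηeq : ∀ t, deriv η t = fderiv ℝ X (x t) (η t))
    (htanξ : ∀ t j, ⟪gradient (fun r' => g r' j) (x t).1, (ξ t).1⟫ = 0)
    (htanη : ∀ t j, ⟪gradient (fun r' => g r' j) (x t).1, (η t).1⟫ = 0) :
    ∀ t s : ℝ,
      ⟪(ξ t).1, (η t).2⟫ - ⟪(ξ t).2, (η t).1⟫
        = ⟪(ξ s).1, (η s).2⟫ - ⟪(ξ s).2, (η s).1⟫ := by
  have hderiv : ∀ t, HasDerivAt (fun t => ⟪(ξ t).1, (η t).2⟫ - ⟪(ξ t).2, (η t).1⟫) 0 t := by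
    intro t
    have hξt := (hξ t).hasDerivAt
    have hηt := (hη t).hasDerivAt
    rw [hξeq] at hξt
    rw [hηeq] at hηt
    have hξ₁ : HasDerivAt (fun t => (ξ t).1) _ t := hξt.hasFDerivAt.fst.hasDerivAt
    have hξ₂ : HasDerivAt (fun t => (ξ t).2) _ t := hξt.hasFDerivAt.snd.hasDerivAt
    have hη₁ : HasDerivAt (fun t => (η t).1) _ t := hηt.hasFDerivAt.fst.hasDerivAt
    have hη₂ : HasDerivAt (fun t => (η t).2) _ t := hηt.hasFDerivAt.snd.hasDerivAt
    refine ((hξ₁.inner ℝ hη₂).sub (hξ₂.inner ℝ hη₁)).congr_deriv ?_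
    simp only [ContinuousLinearMap.comp_apply, ContinuousLinearMap.toSpanSingleton_apply,
      one_smul, ContinuousLinearMap.coe_fst', ContinuousLinearMap.coe_snd']
    have h₁ := symplectic_fderiv_constrained_hamiltonian_field hH hg hlam hX (x t) (ξ t) (η t)
      (htanη t)
    have h₂ := symplectic_fderiv_constrained_hamiltonian_field hH hg hlam hX (x t) (η t) (ξ t)
      (htanξ t)
    have hHsymm : fderiv ℝ (fderiv ℝ H) (x t) (ξ t) (η t)
        = fderiv ℝ (fderiv ℝ H) (x t) (η t) (ξ t) :=
      (hH.contDiffAt.isSymmSndFDerivAt (by simp)).eq _ _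
    have hgsymm : ∀ j, fderiv ℝ (fderiv ℝ (fun r => g r j)) (x t).1 (ξ t).1 (η t).1
        = fderiv ℝ (fderiv ℝ (fun r => g r j)) (x t).1 (η t).1 (ξ t).1 := fun j =>
      ((contDiff_pi.1 hg j).contDiffAt.isSymmSndFDerivAt (by simp)).eq _ _
    simp only [hHsymm, hgsymm] at h₁
    rw [real_inner_comm (fderiv ℝ X (x t) (η t)).2, real_inner_comm (fderiv ℝ X (x t) (η t)).1]
    linarith
  exact is_const_of_deriv_eq_zero (fun t => (hderiv t).differentiableAt)
    fun t => (hderiv t).deriv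
end

section
/- Let X : ℝ^N × ℝ^m → ℝ^N be continuously differentiable and let H : ℝ^N → ℝ be differentiable. Suppose the drift annihilates H: ⟨∇H(x), X(x, 0)⟩ = 0 for all x ∈ ℝ^N. Define the output functions y^l(x, u) = ⟨∇H(x), ∫_0^1 (∂X/∂u_l)(x, θu) dθ⟩ for l = 1, …, m. Then the power balance ⟨∇H(x), X(x, u)⟩ = Σ_{l=1}^m u_l y^l(x, u) holds for all (x, u). -/
open scoped BigOperators RealInnerProductSpace

/-- Hadamard's lemma along the segment from `0` to `u`, in coordinates. -/
theorem ContDiff.sub_apply_zero_eq_sum_integral {ι F : Type*} [Fintype ι] [DecidableEq ι]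
    [NormedAddCommGroup F] [NormedSpace ℝ F] [CompleteSpace F]
    {f : EuclideanSpace ℝ ι → F} (hf : ContDiff ℝ 1 f) (u : EuclideanSpace ℝ ι) :
    f u - f 0 = ∑ l, u l • ∫ θ in (0:ℝ)..1, fderiv ℝ f (θ • u) (EuclideanSpace.single l 1) := by
  have hcont : Continuous fun θ : ℝ => fderiv ℝ f (θ • u) :=
    (hf.continuous_fderiv one_ne_zero).comp (by fun_prop)
  have hu : u = ∑ l, u l • EuclideanSpace.single l (1 : ℝ) := by
    simpa using ((EuclideanSpace.basisFun ι ℝ).sum_repr u).symm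
  have hderiv (θ : ℝ) : HasDerivAt (fun t : ℝ => f (t • u)) (fderiv ℝ f (θ • u) u) θ := by
    simpa [Function.comp_def] using
      (hf.differentiable one_ne_zero (θ • u)).hasFDerivAt.comp_hasDerivAt θ
        ((hasDerivAt_id θ).smul_const u)
  have hftc := intervalIntegral.integral_eq_sub_of_hasDerivAt (a := 0) (b := 1)
    (fun θ _ => hderiv θ) ((hcont.clm_apply continuous_const).intervalIntegrable 0 1)
  have hexpand (θ : ℝ) : fderiv ℝ f (θ • u) u =
      ∑ l, u l • fderiv ℝ f (θ • u) (EuclideanSpace.single l 1) := by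
    generalize fderiv ℝ f (θ • u) = L
    conv_lhs => rw [hu]
    simp only [map_sum, map_smul]
  simp only [one_smul, zero_smul] at hftc
  rw [← hftc]
  simp_rw [hexpand]
  rw [intervalIntegral.integral_finsetSum]
  swap
  · exact fun l _ =>
      ((hcont.clm_apply continuous_const).const_smul (u l)).intervalIntegrable 0 1
  simp only [intervalIntegral.integral_smul]

/-- Passivity of non-affine port-Hamiltonian systems: if the drift annihilates `H`
(`⟨∇H(x), X(x,0)⟩ = 0`), then with the redefined outputs
`y^l(x,u) = ⟨∇H(x), ∫_0^1 (∂X/∂u_l)(x, θ•u) dθ⟩` the power balance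
`⟨∇H(x), X(x,u)⟩ = ∑ l, u_l y^l(x,u)` holds. -/
theorem stmt11 {N m : ℕ}
    (X : EuclideanSpace ℝ (Fin N) × EuclideanSpace ℝ (Fin m) → EuclideanSpace ℝ (Fin N))
    (hX : ContDiff ℝ 1 X)
    (H : EuclideanSpace ℝ (Fin N) → ℝ) (hH : Differentiable ℝ H)
    (hdrift : ∀ x : EuclideanSpace ℝ (Fin N), ⟪gradient H x, X (x, 0)⟫ = 0)
    (y : EuclideanSpace ℝ (Fin N) → EuclideanSpace ℝ (Fin m) → Fin m → ℝ)
    (hy : ∀ x u l, y x u l = ⟪gradient H x,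
      ∫ θ in (0:ℝ)..1,
        fderiv ℝ (fun u' => X (x, u')) (θ • u) (EuclideanSpace.single l 1)⟫) :
    ∀ (x : EuclideanSpace ℝ (Fin N)) (u : EuclideanSpace ℝ (Fin m)),
      ⟪gradient H x, X (x, u)⟫ = ∑ l : Fin m, u l * y x u l := by
  intro x u
  have hdiff := (hX.comp (contDiff_prodMk_right x)).sub_apply_zero_eq_sum_integral u
  calc ⟪gradient H x, X (x, u)⟫ = ⟪gradient H x, X (x, u) - X (x, 0)⟫ := by
        rw [inner_sub_right, hdrift, sub_zero]
    _ = ∑ l : Fin m, u l * y x u l := by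
        simp only [Function.comp_def] at hdiff
        simp only [hdiff, inner_sum, real_inner_smul_right, hy]
end

section
/- Let H_a, H_b : ℝ^n → ℝ be twice continuously differentiable and let x = (q, p) : ℝ → ℝ^n × ℝ^n be a solution of the separable Hamiltonian system q̇(t) = ∇H_b(p(t)), ṗ(t) = −∇H_a(q(t)) with x(0) = (q₀, p₀). Define the Lie–Trotter splitting map ψ_h(q₀, p₀) = (q₀ + h ∇H_b(p₀ − h ∇H_a(q₀)), p₀ − h ∇H_a(q₀)). Then ψ is a first-order method at (q₀, p₀): there exist constants C > 0 and ε > 0 such that ‖ψ_h(q₀, p₀) − x(h)‖ ≤ C h² for all |h| ≤ ε. -/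
open Filter Topology Asymptotics in
/-- Along a curve differentiable at `0`, the gradient of a `C²` function varies at most linearly. -/
theorem gradient_comp_sub_isBigO {F : Type*} [NormedAddCommGroup F] [InnerProductSpace ℝ F]
    [CompleteSpace F] {f : F → ℝ} (hf : ContDiff ℝ 2 f) {c : ℝ → F}
    (hc : DifferentiableAt ℝ c 0) :
    (fun h => gradient f (c h) - gradient f (c 0)) =O[𝓝 0] (fun h : ℝ => h) := by
  have hd : Differentiable ℝ (fderiv ℝ f) :=
    (hf.fderiv_right (m := 1) (by norm_num)).differentiable (by norm_num)
  have key : (fun h => fderiv ℝ f (c h) - fderiv ℝ f (c 0)) =O[𝓝 0] (fun h : ℝ => h - 0) :=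
    ((hd (c 0)).comp (0 : ℝ) hc).isBigO_sub
  simp only [sub_zero] at key
  refine (key.norm_left.congr_left fun h => ?_).of_norm_left
  simp only [gradient, ← map_sub, LinearIsometryEquiv.norm_map]

open Filter Topology Asymptotics in
/-- If the derivative of `f` varies at most linearly at `0`, then the remainder of the first-order
Taylor expansion of `f` at `0` is quadratic. -/
theorem sub_sub_smul_isBigO_sq {F : Type*} [NormedAddCommGroup F] [NormedSpace ℝ F]
    {f g : ℝ → F} (hf : ∀ t, HasDerivAt f (g t) t)
    (hg : (fun h => g h - g 0) =O[𝓝 0] (fun h : ℝ => h)) :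
    (fun h => f h - f 0 - h • g 0) =O[𝓝 0] (fun h : ℝ => h ^ 2) := by
  obtain ⟨C, hC, hbound⟩ := hg.exists_pos
  obtain ⟨ε, hε, hball⟩ := Metric.eventually_nhds_iff.1 hbound.bound
  refine IsBigO.of_bound C (Metric.eventually_nhds_iff.2 ⟨ε, hε, fun h hh => ?_⟩)
  have hderiv : ∀ t ∈ Set.uIcc 0 h, HasDerivWithinAt (fun t => f t - t • g 0) (g t - g 0)
      (Set.uIcc 0 h) t := fun t _ => by
    simpa using ((hf t).fun_sub ((hasDerivAt_id t).smul_const (g 0))).hasDerivWithinAt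
  have hle : ∀ t ∈ Set.uIcc 0 h, ‖g t - g 0‖ ≤ C * |h| := fun t ht => by
    have hth : |t| ≤ |h| := by simpa using Set.abs_sub_left_of_mem_uIcc ht
    refine (hball (y := t) ?_).trans ?_
    · simpa using hth.trans_lt (by simpa using hh)
    · simpa using mul_le_mul_of_nonneg_left hth hC.le
  have := (convex_uIcc 0 h).norm_image_sub_le_of_norm_hasDerivWithin_le hderiv hle
    Set.left_mem_uIcc Set.right_mem_uIcc
  calc ‖f h - f 0 - h • g 0‖ = ‖f h - h • g 0 - (f 0 - (0 : ℝ) • g 0)‖ := by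
        congr 1; simp; abel
    _ ≤ C * |h| * ‖h - 0‖ := this
    _ = C * ‖h ^ 2‖ := by simp [pow_two, mul_assoc]

/-- The Lie–Trotter splitting `ψ_h(q₀,p₀) = (q₀ + h∇H_b(p₀ − h∇H_a(q₀)), p₀ − h∇H_a(q₀))`
is a first-order method for the separable Hamiltonian system
`q̇ = ∇H_b(p)`, `ṗ = −∇H_a(q)`: the local error at `(q₀,p₀)` is `O(h²)`. -/
theorem stmt14 {n : ℕ} (Ha Hb : EuclideanSpace ℝ (Fin n) → ℝ)
    (hHa : ContDiff ℝ 2 Ha) (hHb : ContDiff ℝ 2 Hb)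
    (q p : ℝ → EuclideanSpace ℝ (Fin n)) (q₀ p₀ : EuclideanSpace ℝ (Fin n))
    (hq : ∀ t, HasDerivAt q (gradient Hb (p t)) t)
    (hp : ∀ t, HasDerivAt p (-gradient Ha (q t)) t)
    (hq0 : q 0 = q₀) (hp0 : p 0 = p₀) :
    ∃ C > (0:ℝ), ∃ ε > (0:ℝ), ∀ h : ℝ, |h| ≤ ε →
      ‖((q₀ + h • gradient Hb (p₀ - h • gradient Ha q₀),
          p₀ - h • gradient Ha q₀) :
            EuclideanSpace ℝ (Fin n) × EuclideanSpace ℝ (Fin n))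
        - (q h, p h)‖ ≤ C * h ^ 2 := by
  subst hq0 hp0
  have hpO := sub_sub_smul_isBigO_sq hp
    ((gradient_comp_sub_isBigO hHa (hq 0).differentiableAt).neg_left.congr_left
      fun h => by abel)
  have hqO := sub_sub_smul_isBigO_sq hq
    (gradient_comp_sub_isBigO hHb (hp 0).differentiableAt)
  have hstep := gradient_comp_sub_isBigO hHb
    (c := fun h : ℝ => p 0 - h • gradient Ha (q 0)) (by fun_prop)
  have hsmul := (Asymptotics.isBigO_refl (fun h : ℝ => h) (nhds 0)).smul hstep
  simp only [zero_smul, sub_zero, smul_eq_mul, ← pow_two] at hsmul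
  have hmain := (hsmul.sub hqO).prod_left hpO.neg_left
  obtain ⟨C, hC, hbound⟩ := hmain.exists_pos
  obtain ⟨ε, hε, hball⟩ := Metric.eventually_nhds_iff.1 hbound.bound
  refine ⟨C, hC, ε / 2, by positivity, fun h hh => ?_⟩
  have hfin := hball (y := h) (by rw [Real.dist_eq, sub_zero]; linarith)
  rw [Real.norm_of_nonneg (sq_nonneg h)] at hfin
  convert hfin using 2
  ext1
  · simp only [Prod.fst_sub, smul_sub]
    abel
  · simp only [Prod.snd_sub, smul_neg]
    abel
end

section
/- Let H_a, H_b : ℝ^n → ℝ be three times continuously differentiable and let x = (q, p) : ℝ → ℝ^n × ℝ^n be a solution of the separable Hamiltonian system q̇(t) = ∇H_b(p(t)), ṗ(t) = −∇H_a(q(t)) with x(0) = (q₀, p₀). Define the Strang splitting map Ψ_h(q₀, p₀) = (q₂, p₁), where q₁ = q₀ + (h/2) ∇H_b(p₀), p₁ = p₀ − h ∇H_a(q₁), and q₂ = q₁ + (h/2) ∇H_b(p₁). Then Ψ is a second-order method at (q₀, p₀): there exist constants C > 0 and ε > 0 such that ‖Ψ_h(q₀, p₀) − x(h)‖ ≤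 C h³ for all |h| ≤ ε. -/
open Asymptotics Filter Topology

section Taylor

variable {E : Type*} [NormedAddCommGroup E] [NormedSpace ℝ E]

theorem isBigO_pow_succ_of_hasDerivAt {w w' : ℝ → E} {n : ℕ} (hw : ∀ t, HasDerivAt w (w' t) t)
    (h0 : w 0 = 0) (hO : w' =O[𝓝 0] fun t : ℝ => t ^ n) : w =O[𝓝 0] fun t : ℝ => t ^ (n + 1) := by
  obtain ⟨c, hc, hb⟩ := hO.exists_nonneg
  obtain ⟨δ, hδ, hball⟩ := Metric.eventually_nhds_iff_ball.1 hb.bound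
  refine IsBigO.of_bound c (Metric.eventually_nhds_iff_ball.2 ⟨δ, hδ, fun t ht => ?_⟩)
  have hmem : ∀ s ∈ Metric.closedBall (0 : ℝ) |t|, ‖w' s‖ ≤ c * |t| ^ n := by
    intro s hs
    rw [mem_closedBall_zero_iff, Real.norm_eq_abs] at hs
    rw [mem_ball_zero_iff, Real.norm_eq_abs] at ht
    have h1 := hball s (by rw [mem_ball_zero_iff, Real.norm_eq_abs]; exact hs.trans_lt ht)
    rw [norm_pow, Real.norm_eq_abs] at h1
    exact h1.trans (by gcongr)
  have h2 := (convex_closedBall (0 : ℝ) |t|).norm_image_sub_le_of_norm_hasDerivWithin_le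
    (fun s _ => (hw s).hasDerivWithinAt) hmem (x := 0) (y := t) (by simp) (by simp)
  simpa [h0, pow_succ, mul_assoc] using h2

theorem ContDiff.of_hasDerivAt {v u : ℝ → E} {n : ℕ} (hv : ∀ t, HasDerivAt v (u t) t)
    (hu : ContDiff ℝ n u) : ContDiff ℝ (n + 1) v := by
  have hd : deriv v = u := funext fun t => (hv t).deriv
  refine contDiff_succ_iff_deriv.2 ⟨fun t => (hv t).differentiableAt, by simp, by rwa [hd]⟩

theorem ContDiff.isBigO_sub_linear {u : ℝ → E} {b : E} (hu : ContDiff ℝ 2 u)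
    (hb : HasDerivAt u b 0) : (fun t => u t - (u 0 + t • b)) =O[𝓝 0] fun t : ℝ => t ^ 2 := by
  have hd : Differentiable ℝ u := hu.differentiable (by norm_num)
  have hd' : ContDiff ℝ 1 (deriv u) := hu.deriv'
  refine isBigO_pow_succ_of_hasDerivAt (w' := fun t => deriv u t - b) (n := 1) (fun t => ?_)
    (by simp) ?_
  · simpa using (hd t).hasDerivAt.fun_sub (((hasDerivAt_id t).smul_const b).const_add (u 0))
  · simpa [hb.deriv] using ((hd'.differentiable (by norm_num)) 0).isBigO_sub

theorem isBigO_sub_quadratic_of_hasDerivAt {v u : ℝ → E} {b : E}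
    (hv : ∀ t, HasDerivAt v (u t) t) (hu : ContDiff ℝ 2 u) (hb : HasDerivAt u b 0) :
    (fun t => v t - (v 0 + t • u 0 + (t ^ 2 / 2) • b)) =O[𝓝 0] fun t : ℝ => t ^ 3 := by
  refine isBigO_pow_succ_of_hasDerivAt (n := 2) (fun t => ?_) (by simp) (hu.isBigO_sub_linear hb)
  have h1 : HasDerivAt (fun t : ℝ => t ^ 2 / 2) t t := by
    simpa using (hasDerivAt_pow 2 t).div_const 2
  simpa using (hv t).fun_sub
    ((((hasDerivAt_id t).smul_const (u 0)).const_add (v 0)).fun_add (h1.smul_const b))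

theorem ContDiff.isBigO_smul_sub_quadratic {u : ℝ → E} {b : E} (hu : ContDiff ℝ 2 u)
    (hb : HasDerivAt u b 0) :
    (fun t => t • u t - (t • u 0 + t ^ 2 • b)) =O[𝓝 0] fun t : ℝ => t ^ 3 := by
  have h := (isBigO_refl (fun t : ℝ => t) (𝓝 0)).smul (hu.isBigO_sub_linear hb)
  refine (h.congr_left fun t => ?_).congr_right fun t => ?_
  · module
  · simp only [smul_eq_mul]; ring

/-- The Strang splitting for `q' = f p`, `p' = g q` has local error `O(h³)`. -/
theorem strang_isBigO {f g : E → E} (hf : ContDiff ℝ 2 f) (hg : ContDiff ℝ 2 g) {q p : ℝ → E}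
    (hq : ∀ t, HasDerivAt q (f (p t)) t) (hp : ∀ t, HasDerivAt p (g (q t)) t) {q₁ p₁ q₂ : ℝ → E}
    (hq₁ : ∀ h, q₁ h = q 0 + (h / 2) • f (p 0)) (hp₁ : ∀ h, p₁ h = p 0 + h • g (q₁ h))
    (hq₂ : ∀ h, q₂ h = q₁ h + (h / 2) • f (p₁ h)) :
    (fun h => (q₂ h, p₁ h) - (q h, p h)) =O[𝓝 0] fun h : ℝ => h ^ 3 := by
  have hqc : ContDiff ℝ 0 q :=
    contDiff_zero.2 (Differentiable.continuous fun t => (hq t).differentiableAt)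
  have hpc : ContDiff ℝ 0 p :=
    contDiff_zero.2 (Differentiable.continuous fun t => (hp t).differentiableAt)
  have hq1 : ContDiff ℝ 1 q := by
    simpa using ContDiff.of_hasDerivAt (n := 0) hq ((hf.of_le (by norm_num)).comp hpc)
  have hp1 : ContDiff ℝ 1 p := by
    simpa using ContDiff.of_hasDerivAt (n := 0) hp ((hg.of_le (by norm_num)).comp hqc)
  have hq2 : ContDiff ℝ 2 q :=
    ContDiff.of_hasDerivAt (n := 1) hq ((hf.of_le (by norm_num)).comp hp1)
  have hp2 : ContDiff ℝ 2 p :=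
    ContDiff.of_hasDerivAt (n := 1) hp ((hg.of_le (by norm_num)).comp hq1)
  have hfd : ∀ x, HasFDerivAt f (fderiv ℝ f x) x := fun x =>
    (hf.differentiable (by norm_num) x).hasFDerivAt
  have hgd : ∀ x, HasFDerivAt g (fderiv ℝ g x) x := fun x =>
    (hg.differentiable (by norm_num) x).hasFDerivAt
  have hq₁0 : q₁ 0 = q 0 := by simp [hq₁]
  have hp₁0 : p₁ 0 = p 0 := by simp [hp₁]
  have hq₁c : ContDiff ℝ 2 q₁ := by
    rw [funext hq₁]; fun_prop
  have hp₁c : ContDiff ℝ 2 p₁ := by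
    rw [funext hp₁]; fun_prop
  have hq₁d : HasDerivAt q₁ ((1 / 2 : ℝ) • f (p 0)) 0 := by
    rw [funext hq₁]
    exact (((hasDerivAt_id (0 : ℝ)).div_const 2).smul_const _).const_add _
  have hgq₁d : HasDerivAt (fun h => g (q₁ h)) (fderiv ℝ g (q 0) ((1 / 2 : ℝ) • f (p 0))) 0 := by
    have := hgd (q₁ 0)
    rw [hq₁0] at this
    exact HasFDerivAt.comp_hasDerivAt_of_eq 0 this hq₁d hq₁0.symm
  have hp₁d : HasDerivAt p₁ (g (q 0)) 0 := by
    rw [funext hp₁]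
    simpa [hq₁0] using ((hasDerivAt_id (0 : ℝ)).smul hgq₁d).const_add (p 0)
  have hfp₁d : HasDerivAt (fun h => f (p₁ h)) (fderiv ℝ f (p 0) (g (q 0))) 0 :=
    HasFDerivAt.comp_hasDerivAt_of_eq 0 (hfd (p 0)) hp₁d hp₁0.symm
  have hqO := isBigO_sub_quadratic_of_hasDerivAt hq (hf.comp hp2)
    ((hfd (p 0)).comp_hasDerivAt 0 (hp 0))
  have hpO := isBigO_sub_quadratic_of_hasDerivAt hp (hg.comp hq2)
    ((hgd (q 0)).comp_hasDerivAt 0 (hq 0))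
  have hp₁O := (hg.comp hq₁c).isBigO_smul_sub_quadratic hgq₁d
  have hq₂O := ((hf.comp hp₁c).isBigO_smul_sub_quadratic hfp₁d).const_smul_left (1 / 2 : ℝ)
  refine IsBigO.prod_left ((hq₂O.sub hqO).congr_left fun h => ?_)
    ((hp₁O.sub hpO).congr_left fun h => ?_)
  · simp only [Pi.smul_apply, Function.comp_apply, hq₂, hq₁, hp₁0]
    module
  · simp only [Function.comp_apply, hp₁ h, hq₁0, map_smul]
    module

end Taylor

theorem ContDiff.gradient {F : Type*} [NormedAddCommGroup F] [InnerProductSpace ℝ F]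
    [CompleteSpace F] {H : F → ℝ} {m n : WithTop ℕ∞} (hH : ContDiff ℝ n H) (hmn : m + 1 ≤ n) :
    ContDiff ℝ m (gradient H) :=
  (InnerProductSpace.toDual ℝ F).symm.contDiff.comp (hH.fderiv_right hmn)

/-- The Strang splitting `Ψ_h(q₀,p₀) = (q₂, p₁)` with
`q₁ = q₀ + (h/2)∇H_b(p₀)`, `p₁ = p₀ − h∇H_a(q₁)`, `q₂ = q₁ + (h/2)∇H_b(p₁)`
is a second-order method for the separable Hamiltonian system
`q̇ = ∇H_b(p)`, `ṗ = −∇H_a(q)`: the local error at `(q₀,p₀)` is `O(h³)`. -/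
theorem stmt15 {n : ℕ} (Ha Hb : EuclideanSpace ℝ (Fin n) → ℝ)
    (hHa : ContDiff ℝ 3 Ha) (hHb : ContDiff ℝ 3 Hb)
    (q p : ℝ → EuclideanSpace ℝ (Fin n)) (q₀ p₀ : EuclideanSpace ℝ (Fin n))
    (hq : ∀ t, HasDerivAt q (gradient Hb (p t)) t)
    (hp : ∀ t, HasDerivAt p (-gradient Ha (q t)) t)
    (hq0 : q 0 = q₀) (hp0 : p 0 = p₀) :
    ∃ C > (0:ℝ), ∃ ε > (0:ℝ), ∀ h : ℝ, |h| ≤ ε →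
      ∀ q₁ p₁ q₂ : EuclideanSpace ℝ (Fin n),
        q₁ = q₀ + (h / 2) • gradient Hb p₀ →
        p₁ = p₀ - h • gradient Ha q₁ →
        q₂ = q₁ + (h / 2) • gradient Hb p₁ →
        ‖((q₂, p₁) : EuclideanSpace ℝ (Fin n) × EuclideanSpace ℝ (Fin n))
          - (q h, p h)‖ ≤ C * |h| ^ 3 := by
  subst hq0 hp0
  have hO := strang_isBigO (f := gradient Hb) (g := fun x => -gradient Ha x)
    (hHb.gradient (by norm_num)) (hHa.gradient (by norm_num)).neg hq hp
    (fun _ => rfl) (fun _ => rfl) (fun _ => rfl)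
  obtain ⟨C, hC, hb⟩ := hO.exists_pos
  obtain ⟨ε, hε, hball⟩ := Metric.eventually_nhds_iff_ball.1 hb.bound
  refine ⟨C, hC, ε / 2, half_pos hε, ?_⟩
  rintro h hh _ _ _ rfl rfl rfl
  have := hball h (by rw [mem_ball_zero_iff, Real.norm_eq_abs]; linarith)
  simpa [sub_eq_add_neg] using this
end

section
/- Let l_a, l_b > 0 and let r = (r^{a_x}, r^{a_y}, r^{b_x}, r^{b_y}) ∈ ℝ^4 satisfy the double-pendulum constraints (r^{a_x})² + (r^{a_y})² = l_a² and (r^{δ_x})² + (r^{δ_y})² = l_b², where r^{δ_x} = r^{b_x} − r^{a_x} and r^{δ_y} = r^{b_y} − r^{a_y}. Then the 2 × 4 constraint Jacobian matrix G(r) = [[r^{a_x}, r^{a_y}, 0, 0], [−r^{δ_x}, −r^{δ_y}, r^{δ_x}, r^{δ_y}]] has rank 2. -/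
open Matrix

/-- The constraint Jacobian of the double planar pendulum has full rank 2 on the
constraint set: if `(r^{a_x})² + (r^{a_y})² = l_a²` and `(r^{δ_x})² + (r^{δ_y})² = l_b²`
with `r^δ = r^b − r^a` and `l_a, l_b > 0`, then
`G(r) = [[r^{a_x}, r^{a_y}, 0, 0], [−r^{δ_x}, −r^{δ_y}, r^{δ_x}, r^{δ_y}]]` has rank 2. -/
theorem stmt18 (la lb : ℝ) (hla : 0 < la) (hlb : 0 < lb)
    (rax ray rbx rby : ℝ)
    (h1 : rax ^ 2 + ray ^ 2 = la ^ 2)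
    (h2 : (rbx - rax) ^ 2 + (rby - ray) ^ 2 = lb ^ 2) :
    (!![rax, ray, 0, 0;
        -(rbx - rax), -(rby - ray), rbx - rax, rby - ray] :
      Matrix (Fin 2) (Fin 4) ℝ).rank = 2 := by
  suffices h : LinearIndependent ℝ (!![rax, ray, 0, 0;
      -(rbx - rax), -(rby - ray), rbx - rax, rby - ray] : Matrix (Fin 2) (Fin 4) ℝ).row by
    simpa using h.rank_matrix
  refine Fintype.linearIndependent_iff.2 fun c hc => ?_
  have e0 := congrFun hc 0
  have e1 := congrFun hc 1
  have e2 := congrFun hc 2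
  have e3 := congrFun hc 3
  simp [Fin.sum_univ_two, Matrix.row, -mul_eq_zero] at e0 e1 e2 e3
  have hc1 : c 1 = 0 := by
    have : c 1 * lb ^ 2 = 0 := by
      linear_combination (rbx - rax) * e2 + (rby - ray) * e3 - c 1 * h2
    exact (mul_eq_zero.1 this).resolve_right (by positivity)
  have hc0 : c 0 = 0 := by
    have : c 0 * la ^ 2 = 0 := by
      linear_combination rax * (e0 + e2) + ray * (e1 + e3) - c 0 * h1
    exact (mul_eq_zero.1 this).resolve_right (by positivity)
  exact Fin.forall_fin_two.2 ⟨hc0, hc1⟩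
end
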